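/- Let p > 0 and ω ≥ 0. If η, η' ∈ ℝ² satisfy |η|_p = |η'|_p with p = 2 (i.e. equal Euclidean norms), then J_ω^[2](η) = J_ω^[2](η'); that is, the generalized Bessel function J_ω^[2] is spherically symmetric on ℝ². -/

import Mathlib

open Real MeasureTheory

/-- The `p`-norm of a point of `ℝ²`. -/
noncomputable def pnorm (p : ℝ) (x : ℝ × ℝ) : ℝ := (|x.1| ^ p + |x.2| ^ p) ^ (1 / p)

/-- The generalized Bessel function of order zero `J₀^[p]`. -/
noncomputable def Jzero (p : ℝ) (η : ℝ × ℝ) : ℝ :=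
  (1 / Real.Gamma (1 / p) ^ 2) * (2 / p) ^ 2 *
    ∫ t in (0:ℝ)..1,
      Real.cos (η.1 * t ^ (1 / p)) * Real.cos (η.2 * (1 - t) ^ (1 / p)) *
        t ^ (1 / p - 1) * (1 - t) ^ (1 / p - 1)

/-- The generalized Bessel function of positive order `J_ω^[p]`. -/
noncomputable def Jord (p ω : ℝ) (η : ℝ × ℝ) : ℝ :=
  pnorm p η ^ ω / (p ^ (ω - 1) * Real.Gamma ω) *
    ∫ τ in (0:ℝ)..1, Jzero p (τ * η.1, τ * η.2) * τ * (1 - τ ^ p) ^ (ω - 1)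

/-- `e^{2πiθ}`. -/
noncomputable def e2πi (θ : ℝ) : ℂ := Complex.exp (((2 * Real.pi * θ : ℝ) : ℂ) * Complex.I)

/-- The integral version `𝒟_β^[p](s : x)`. -/
noncomputable def Dcal (p β s : ℝ) (x : ℝ × ℝ) : ℂ :=
  ((1 / Real.Gamma (β + 1) : ℝ) : ℂ) *
    ∫ ξ in {ξ : ℝ × ℝ | pnorm p ξ ^ p < s},
      (((s - pnorm p ξ ^ p) ^ β : ℝ) : ℂ) * e2πi (x.1 * ξ.1 + x.2 * ξ.2)

/-- The lattice sum version `D_β^[p](s : x)`. -/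
noncomputable def Dlat (p β s : ℝ) (x : ℝ × ℝ) : ℂ :=
  ((1 / Real.Gamma (β + 1) : ℝ) : ℂ) *
    ∑' m : ℤ × ℤ,
      if pnorm p ((m.1 : ℝ), (m.2 : ℝ)) ^ p < s then
        (((s - pnorm p ((m.1 : ℝ), (m.2 : ℝ)) ^ p) ^ β : ℝ) : ℂ) *
          e2πi (x.1 * (m.1 : ℝ) + x.2 * (m.2 : ℝ))
      else 0

/-- Generalized Bessel function of nonnegative order `J_ω^[p]` (of order zero when `ω = 0`). -/
noncomputable def Jgen (p ω : ℝ) (η : ℝ × ℝ) : ℝ :=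
  if ω = 0 then Jzero p η else Jord p ω η

open Set in
/-- The substitution `t = sin² θ` on the open unit interval. -/
lemma integral_comp_sin_sq (g : ℝ → ℝ) :
    ∫ t in (0:ℝ)..1, g t =
      ∫ θ in (0:ℝ)..(π / 2), 2 * sin θ * cos θ * g (sin θ ^ 2) := by
  have himg : (fun θ : ℝ => sin θ ^ 2) '' Ioo 0 (π / 2) = Ioo 0 1 := by
    ext t
    constructor
    · rintro ⟨θ, ⟨h0, h1⟩, rfl⟩
      have hs : 0 < sin θ := sin_pos_of_pos_of_lt_pi h0 (by linarith [pi_pos])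
      have hc : 0 < cos θ := cos_pos_of_mem_Ioo ⟨by linarith, h1⟩
      exact ⟨by positivity, by nlinarith [sin_sq_add_cos_sq θ]⟩
    · rintro ⟨h0, h1⟩
      have hs : √t < 1 := by rw [sqrt_lt' one_pos]; simpa using h1
      refine ⟨arcsin √t, ⟨arcsin_pos.2 (sqrt_pos.2 h0), arcsin_lt_pi_div_two.2 hs⟩, ?_⟩
      simp only
      rw [sin_arcsin (by linarith [sqrt_nonneg t]) hs.le, sq_sqrt h0.le]
  have hinj : InjOn (fun θ : ℝ => sin θ ^ 2) (Ioo 0 (π / 2)) := by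
    rintro x ⟨hx0, hx1⟩ y ⟨hy0, hy1⟩ hxy
    have hx : 0 < sin x := sin_pos_of_pos_of_lt_pi hx0 (by linarith [pi_pos])
    have hy : 0 < sin y := sin_pos_of_pos_of_lt_pi hy0 (by linarith [pi_pos])
    exact injOn_sin ⟨by linarith, hx1.le⟩ ⟨by linarith, hy1.le⟩
      ((pow_left_inj₀ hx.le hy.le two_ne_zero).1 hxy)
  have hderiv : ∀ θ ∈ Ioo (0:ℝ) (π / 2),
      HasDerivWithinAt (fun θ : ℝ => sin θ ^ 2) (2 * sin θ * cos θ) (Ioo 0 (π / 2)) θ := by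
    intro θ _
    simpa using ((hasDerivAt_sin θ).fun_pow 2).hasDerivWithinAt
  rw [intervalIntegral.integral_of_le zero_le_one,
    intervalIntegral.integral_of_le (by positivity), integral_Ioc_eq_integral_Ioo,
    integral_Ioc_eq_integral_Ioo, ← himg,
    integral_image_eq_integral_abs_deriv_smul measurableSet_Ioo hderiv hinj]
  refine setIntegral_congr_fun measurableSet_Ioo fun θ hθ => ?_
  have hs : 0 < sin θ := sin_pos_of_pos_of_lt_pi hθ.1 (by linarith [pi_pos, hθ.2])
  have hc : 0 < cos θ := cos_pos_of_mem_Ioo ⟨by linarith [hθ.1, pi_pos], hθ.2⟩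
  simp only [smul_eq_mul]
  rw [abs_of_pos (by positivity)]

/-- The trigonometric form of the integral defining `J₀^[2]`. -/
lemma Jzero_two_integral_eq (a b : ℝ) :
    (∫ t in (0:ℝ)..1,
      cos (a * t ^ (1 / (2:ℝ))) * cos (b * (1 - t) ^ (1 / (2:ℝ))) *
        t ^ (1 / (2:ℝ) - 1) * (1 - t) ^ (1 / (2:ℝ) - 1)) =
      ∫ θ in (0:ℝ)..(π / 2), 2 * (cos (a * sin θ) * cos (b * cos θ)) := by
  have hpow : ∀ s : ℝ, 0 < s →
      (s ^ 2) ^ (1 / (2:ℝ)) = s ∧ (s ^ 2) ^ (1 / (2:ℝ) - 1) = s⁻¹ := by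
    intro s hs
    have h1 : (s ^ 2) ^ (1 / (2:ℝ)) = s := by
      rw [← sqrt_eq_rpow, sqrt_sq hs.le]
    refine ⟨h1, ?_⟩
    rw [rpow_sub (by positivity), h1, rpow_one]
    field_simp
  rw [integral_comp_sin_sq, intervalIntegral.integral_of_le (by positivity),
    intervalIntegral.integral_of_le (by positivity), integral_Ioc_eq_integral_Ioo,
    integral_Ioc_eq_integral_Ioo]
  refine setIntegral_congr_fun measurableSet_Ioo fun θ hθ => ?_
  have hs : 0 < sin θ := sin_pos_of_pos_of_lt_pi hθ.1 (by linarith [pi_pos, hθ.2])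
  have hc : 0 < cos θ := cos_pos_of_mem_Ioo ⟨by linarith [hθ.1, pi_pos], hθ.2⟩
  rw [← cos_sq', (hpow _ hs).1, (hpow _ hs).2, (hpow _ hc).1, (hpow _ hc).2]
  field_simp

/-- The trigonometric integral depends only on `√(a² + b²)`. -/
lemma integral_cos_mul_cos_eq_norm (a b : ℝ) :
    ∫ θ in (0:ℝ)..(π / 2), 2 * (cos (a * sin θ) * cos (b * cos θ)) =
      ∫ θ in (0:ℝ)..π, cos (√(a ^ 2 + b ^ 2) * cos θ) := by
  set r := √(a ^ 2 + b ^ 2) with hr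
  obtain ⟨φ, ha, hb⟩ : ∃ φ : ℝ, a = r * sin φ ∧ b = r * cos φ := by
    have hn : ‖(⟨b, a⟩ : ℂ)‖ = r := by
      rw [Complex.norm_def, Complex.normSq_mk, hr]
      congr 1
      ring
    refine ⟨Complex.arg ⟨b, a⟩, ?_, ?_⟩
    · rw [← hn, Complex.norm_mul_sin_arg]
    · rw [← hn, Complex.norm_mul_cos_arg]
  let F : ℝ → ℝ := fun θ => cos (r * cos θ)
  have hF : Continuous F := by fun_prop
  have hper : Function.Periodic F π := fun θ => by
    simp only [F]
    rw [cos_add_pi, mul_neg, cos_neg]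
  have hsplit : ∀ θ, 2 * (cos (a * sin θ) * cos (b * cos θ)) = F (θ - φ) + F (-θ - φ) := by
    intro θ
    simp only [F]
    have h1 : r * cos (θ - φ) = b * cos θ + a * sin θ := by
      rw [cos_sub, ha, hb]; ring
    have h2 : r * cos (-θ - φ) = b * cos θ - a * sin θ := by
      rw [cos_sub, cos_neg, sin_neg, ha, hb]; ring
    rw [h1, h2, cos_add, cos_sub]
    ring
  have hint : ∀ c d : ℝ, IntervalIntegrable (fun θ => F (θ - φ)) volume c d := fun c d =>
    (by fun_prop : Continuous fun θ => F (θ - φ)).intervalIntegrable c d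
  have hneg : ∫ θ in (0:ℝ)..(π / 2), F (-θ - φ) = ∫ θ in (-(π / 2))..0, F (θ - φ) := by
    simpa using intervalIntegral.integral_comp_neg (a := 0) (b := π / 2) fun θ => F (θ - φ)
  simp_rw [hsplit]
  rw [intervalIntegral.integral_add (hint _ _)
      ((by fun_prop : Continuous fun θ => F (-θ - φ)).intervalIntegrable _ _), hneg, add_comm,
    intervalIntegral.integral_add_adjacent_intervals (hint _ _) (hint _ _),
    intervalIntegral.integral_comp_sub_right]
  have h := hper.intervalIntegral_add_eq (-(π / 2) - φ) 0
  rw [zero_add, show -(π / 2) - φ + π = π / 2 - φ by ring] at h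
  exact h

/-- `J₀^[2]` depends only on the sum of squares of the coordinates. -/
lemma Jzero_two_congr {η η' : ℝ × ℝ} (h : η.1 ^ 2 + η.2 ^ 2 = η'.1 ^ 2 + η'.2 ^ 2) :
    Jzero 2 η = Jzero 2 η' := by
  unfold Jzero
  rw [Jzero_two_integral_eq, Jzero_two_integral_eq, integral_cos_mul_cos_eq_norm,
    integral_cos_mul_cos_eq_norm, h]

/-- The `2`-norm is the Euclidean norm. -/
lemma pnorm_two (η : ℝ × ℝ) : pnorm 2 η = √(η.1 ^ 2 + η.2 ^ 2) := by
  simp [pnorm, sqrt_eq_rpow]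

/-- `J_ω^[2]` is spherically symmetric: it depends only on the Euclidean norm. -/
theorem Jgen_two_spherically_symmetric (p ω : ℝ) (hp : 0 < p) (hω : 0 ≤ ω)
    (η η' : ℝ × ℝ) (h : pnorm 2 η = pnorm 2 η') :
    Jgen 2 ω η = Jgen 2 ω η' := by
  have hsq : η.1 ^ 2 + η.2 ^ 2 = η'.1 ^ 2 + η'.2 ^ 2 := by
    rwa [pnorm_two, pnorm_two, sqrt_inj (by positivity) (by positivity)] at h
  have hscale : ∀ τ : ℝ, Jzero 2 (τ * η.1, τ * η.2) = Jzero 2 (τ * η'.1, τ * η'.2) := fun τ =>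
    Jzero_two_congr (by simp only; linear_combination τ ^ 2 * hsq)
  simp only [Jgen, Jord, h, hscale, Jzero_two_congr hsq]
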